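/- Let {Q(t)}_{t≥0} be an ergodic stochastic chain with absolute probability sequence {ψ(t)}_{t≥0}. Then for every t ∈ ℕ and every stochastic vector p_∞ ∈ ℝ^n, the limit lim_{t_∞→∞} p_∞^T Q(t_∞:t) exists and equals ψ(t)^T; in particular this limit is independent of p_∞. Consequently, for the time-reversed inhomogeneous Markov chain z^T(s) = z^T(s+1)A(s) started at time t_∞ with distribution Pr(z(t_∞) = e^(i)) = (p_∞)_i, the limiting distribution p_i(t) := lim_{t_∞→∞} Pr(z(t) = e^(i)) exists and equals ψ_i(t) for every i and t, invariant with respect to p_∞. (Sufficiency direction of Theorem 3.) -/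

import Mathlib

open MeasureTheory ProbabilityTheory Filter Finset

/-- Backward matrix product `M(t2:t1) = M(t2-1) * M(t2-2) * ⋯ * M(t1)`, with `bprod M t t = 1`. -/
def bprod {n : ℕ} (M : ℕ → Matrix (Fin n) (Fin n) ℝ) (t2 t1 : ℕ) : Matrix (Fin n) (Fin n) ℝ :=
  ((List.range (t2 - t1)).map fun k => M (t2 - 1 - k)).prod

/-- A vector in ℝⁿ is stochastic if its entries are nonnegative and sum to 1. -/
def IsStochasticVec {n : ℕ} (v : Fin n → ℝ) : Prop := (∀ i, 0 ≤ v i) ∧ ∑ i, v i = 1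

/-- An n×n real matrix is (row-)stochastic if its entries are nonnegative and
each row sums to 1. -/
def IsStochasticMat {n : ℕ} (M : Matrix (Fin n) (Fin n) ℝ) : Prop :=
  (∀ i j, 0 ≤ M i j) ∧ ∀ i, ∑ j, M i j = 1

/-- A chain of stochastic matrices is ergodic if every backward product `Q(t:t0)`
converges (entrywise) to a rank-one matrix `1ψ(t0)ᵀ` with `ψ(t0)` stochastic. -/
def IsErgodicChain {n : ℕ} (Q : ℕ → Matrix (Fin n) (Fin n) ℝ) : Prop :=
  ∀ t0 : ℕ, ∃ ψ : Fin n → ℝ, IsStochasticVec ψ ∧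
    ∀ i j, Tendsto (fun t => bprod Q t t0 i j) atTop (nhds (ψ j))

theorem bprod_self {n : ℕ} (M : ℕ → Matrix (Fin n) (Fin n) ℝ) (t : ℕ) : bprod M t t = 1 := by
  simp [bprod]

theorem bprod_succ {n : ℕ} (M : ℕ → Matrix (Fin n) (Fin n) ℝ) {t1 t2 : ℕ} (h : t1 ≤ t2) :
    bprod M (t2 + 1) t1 = M t2 * bprod M t2 t1 := by
  unfold bprod
  rw [Nat.sub_add_comm h, List.range_succ_eq_map, List.map_cons, List.prod_cons, List.map_map]
  congr 3
  funext k
  simp only [Function.comp_apply]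
  congr 1
  omega

/-- An absolute probability sequence is transported backwards by the products of the chain. -/
theorem vecMul_bprod_eq {n : ℕ} {Q : ℕ → Matrix (Fin n) (Fin n) ℝ} {ψ : ℕ → Fin n → ℝ}
    (hψ : ∀ t, Matrix.vecMul (ψ (t + 1)) (Q t) = ψ t) {t T : ℕ} (h : t ≤ T) :
    Matrix.vecMul (ψ T) (bprod Q T t) = ψ t := by
  induction T, h using Nat.le_induction with
  | base => rw [bprod_self, Matrix.vecMul_one]
  | succ T h ih => rw [bprod_succ Q h, ← Matrix.vecMul_vecMul, hψ, ih]

/-- Averages, with weights that may vary, of families converging to a common limit converge to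
that limit. -/
theorem tendsto_sum_stochasticVec_mul {n : ℕ} {α : Type*} {l : Filter α} {w a : α → Fin n → ℝ}
    {c : ℝ} (hw : ∀ x, IsStochasticVec (w x)) (ha : ∀ i, Tendsto (fun x => a x i) l (nhds c)) :
    Tendsto (fun x => ∑ i, w x i * a x i) l (nhds c) := by
  have hsum : Tendsto (fun x => ∑ i, |a x i - c|) l (nhds 0) := by
    simpa using tendsto_finsetSum univ fun i _ => ((ha i).sub_const c).abs
  refine tendsto_iff_dist_tendsto_zero.2 (squeeze_zero (fun _ => dist_nonneg) (fun x => ?_) hsum)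
  obtain ⟨h0, h1⟩ := hw x
  have hle : ∀ i, w x i ≤ 1 := fun i =>
    h1 ▸ single_le_sum (fun j _ => h0 j) (mem_univ i)
  calc dist (∑ i, w x i * a x i) c = |∑ i, w x i * (a x i - c)| := by
        rw [Real.dist_eq]
        simp only [mul_sub, sum_sub_distrib, ← sum_mul, h1, one_mul]
    _ ≤ ∑ i, |w x i * (a x i - c)| := abs_sum_le_sum_abs _ _
    _ ≤ ∑ i, |a x i - c| := sum_le_sum fun i _ => by
        rw [abs_mul, abs_of_nonneg (h0 i)]
        exact mul_le_of_le_one_left (abs_nonneg _) (hle i)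

/-- **Sufficiency direction of Theorem 3.** If `{Q(t)}` is an ergodic stochastic
chain with absolute probability sequence `{ψ(t)}`, then for every time `t` and
every stochastic vector `p∞`, the limit `lim_{t∞→∞} p∞ᵀ Q(t∞:t)` exists and
equals `ψ(t)ᵀ`; in particular it is independent of `p∞`. Hence the limiting
distribution of the time-reversed inhomogeneous Markov chain (whose distribution
at time `t` started from `p∞` at time `t∞` is `p∞ᵀ Q(t∞:t)`) is `ψ(t)`. -/
theorem time_reversed_limit_eq_absolute_probability
    (n : ℕ) (Q : ℕ → Matrix (Fin n) (Fin n) ℝ)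
    (hQ : ∀ t, IsStochasticMat (Q t))
    (herg : IsErgodicChain Q)
    (ψ : ℕ → Fin n → ℝ) (hψ : ∀ t, IsStochasticVec (ψ t))
    (hAPS : ∀ t j, ∑ i, ψ (t + 1) i * Q t i j = ψ t j) :
    ∀ (t : ℕ) (pinf : Fin n → ℝ), IsStochasticVec pinf →
      ∀ j, Tendsto (fun tinf => ∑ i, pinf i * bprod Q tinf t i j) atTop
        (nhds (ψ t j)) := by
  intro t pinf hpinf j
  obtain ⟨φ, -, hφ⟩ := herg t
  have hψφ : ψ t j = φ j := by
    refine tendsto_nhds_unique (tendsto_const_nhds.congr' ?_)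
      (tendsto_sum_stochasticVec_mul hψ fun i => hφ i j)
    filter_upwards [eventually_ge_atTop t] with T hT
    exact (congrFun (vecMul_bprod_eq (fun s => funext (hAPS s)) hT) j).symm
  rw [hψφ]
  exact tendsto_sum_stochasticVec_mul (fun _ => hpinf) fun i => hφ i j
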